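/- arXiv:1811.02264 — 2 statements merged into one kernel-verified Lean document; each statement's English description precedes it below -/
import Mathlib

section
/- Let X be a Hausdorff topological space. Then the cardinality of X is at most g(X)^{L(X) · t(X)}, where g(X) is the depth of X, L(X) the Lindelöf number and t(X) the tightness of X. -/
open Cardinal Set

universe u

/-- The depth `g(X)`: the supremum of the cardinalities of closures of discrete subsets. -/
noncomputable def depth (X : Type u) [TopologicalSpace X] : Cardinal.{u} :=
  ⨆ D : {D : Set X // DiscreteTopology D}, #(closure (D : Set X))

/-- The Lindelöf number `L(X)`: the least infinite cardinal `κ` such that every open cover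
has a subcover of cardinality at most `κ`. -/
noncomputable def lindelofNumber (X : Type u) [TopologicalSpace X] : Cardinal.{u} :=
  sInf {κ : Cardinal.{u} | ℵ₀ ≤ κ ∧ ∀ 𝒰 : Set (Set X), (∀ U ∈ 𝒰, IsOpen U) → ⋃₀ 𝒰 = Set.univ →
    ∃ 𝒱 ⊆ 𝒰, #𝒱 ≤ κ ∧ ⋃₀ 𝒱 = Set.univ}

/-- The tightness `t(X)`: the least infinite cardinal `κ` such that whenever `x ∈ closure A`
there is `B ⊆ A` with `#B ≤ κ` and `x ∈ closure B`. -/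
noncomputable def tightness (X : Type u) [TopologicalSpace X] : Cardinal.{u} :=
  sInf {κ : Cardinal.{u} | ℵ₀ ≤ κ ∧ ∀ (A : Set X) (x : X), x ∈ closure A →
    ∃ B ⊆ A, #B ≤ κ ∧ x ∈ closure B}

theorem aux_mk_biUnion_le {α ι : Type u} {κ : Cardinal.{u}} (hκ : ℵ₀ ≤ κ) (s : Set ι)
    (A : ι → Set α) (hs : #s ≤ κ) (hA : ∀ i ∈ s, #(A i) ≤ κ) : #(⋃ i ∈ s, A i : Set α) ≤ κ := by
  refine (Cardinal.mk_biUnion_le A s).trans ?_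
  refine (mul_le_mul' hs (ciSup_le' (a := κ) fun i : s => hA i.1 i.2)).trans ?_
  exact (Cardinal.mul_eq_self hκ).le

/-- Every set of size at most `#G` is covered by the range of a function on `G`. -/
theorem aux_cover {X G : Type u} (x0 : X) (C : Set X) (h : #C ≤ #G) :
    ∃ f : G → X, C ⊆ range f := by
  obtain ⟨e⟩ := h
  refine ⟨Function.extend e Subtype.val (fun _ => x0), fun c hc => ⟨e ⟨c, hc⟩, ?_⟩⟩
  rw [e.injective.extend_apply]

theorem aux_exact {X K : Type u} (C : Set X) (hne : C.Nonempty) (h : #C ≤ #K) :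
    ∃ f : K → X, range f = C := by
  obtain ⟨c, hc⟩ := hne
  obtain ⟨f, hf⟩ := aux_cover (⟨c, hc⟩ : C) (Set.univ : Set C) (G := K) (by simpa using h)
  refine ⟨fun k => (f k).1, ?_⟩
  ext y
  constructor
  · rintro ⟨k, rfl⟩
    exact (f k).2
  · intro hy
    obtain ⟨k, hk⟩ := hf (mem_univ ⟨y, hy⟩)
    exact ⟨k, by simp [hk]⟩

/-- Transfinite recursion. -/
theorem aux_rec {X I : Type u} [LinearOrder I] [WellFoundedLT I] (p : X) (Φ : I → (I → X) → X)
    (hΦ : ∀ a x y, (∀ b, b < a → x b = y b) → Φ a x = Φ a y) :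
    ∃ x : I → X, ∀ a, x a = Φ a x := by
  classical
  let F : (a : I) → ((b : I) → b < a → X) → X :=
    fun a r => Φ a (fun b => if h : b < a then r b h else p)
  refine ⟨(wellFounded_lt (α := I)).fix F, fun a => ?_⟩
  conv_lhs => rw [WellFounded.fix_eq]
  apply hΦ
  intro b hb
  simp [hb]

/-- A Shapirovskii type lemma. -/
theorem aux_shap {X : Type u} [TopologicalSpace X] (x : X) (V : X → Set X)
    (hV : ∀ y, y ≠ x → IsOpen (V y) ∧ y ∈ V y) :
    ∃ D : Set X, DiscreteTopology D ∧ x ∉ D ∧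
      ∀ y, y ≠ x → y ∈ closure D ∨ ∃ d ∈ D, y ∈ V d := by
  classical
  letI : LinearOrder X := WellOrderingRel.isWellOrder.linearOrder
  haveI : WellFoundedLT X := WellOrderingRel.isWellOrder.toIsWellFounded
  let Φ : X → (X → ULift.{u} Prop) → ULift.{u} Prop := fun y P =>
    ⟨y ≠ x ∧ y ∉ closure {d | d < y ∧ (P d).down} ∧ ∀ d, d < y → (P d).down → y ∉ V d⟩
  obtain ⟨P, hP⟩ := aux_rec (X := ULift.{u} Prop) (I := X) ⟨True⟩ Φ (by
    intro a P Q h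
    have h1 : {d | d < a ∧ (P d).down} = {d | d < a ∧ (Q d).down} := by
      ext d
      constructor
      · rintro ⟨h1, h2⟩
        exact ⟨h1, by rw [← h d h1]; exact h2⟩
      · rintro ⟨h1, h2⟩
        exact ⟨h1, by rw [h d h1]; exact h2⟩
    have h2 : (∀ d, d < a → (P d).down → a ∉ V d) ↔ (∀ d, d < a → (Q d).down → a ∉ V d) := by
      constructor
      · intro h3 d hd hq
        exact h3 d hd (by rw [h d hd]; exact hq)
      · intro h3 d hd hq
        exact h3 d hd (by rw [← h d hd]; exact hq)
    simp only [Φ, h1, h2])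
  have key : ∀ y, (P y).down ↔
      (y ≠ x ∧ y ∉ closure {d | d < y ∧ (P d).down} ∧ ∀ d, d < y → (P d).down → y ∉ V d) := by
    intro y
    conv_lhs => rw [hP y]
  refine ⟨{d | (P d).down}, ?_, ?_, ?_⟩
  · rw [discreteTopology_subtype_iff']
    intro y hy
    obtain ⟨h1, h2, h3⟩ := (key y).1 hy
    refine ⟨V y ∩ (closure {d | d < y ∧ (P d).down})ᶜ,
      (hV y h1).1.inter isClosed_closure.isOpen_compl, ?_⟩
    ext z
    constructor
    · rintro ⟨⟨hz1, hz2⟩, hz3⟩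
      rcases lt_trichotomy z y with h | h | h
      · exact absurd (subset_closure (show z ∈ {d | d < y ∧ (P d).down} from ⟨h, hz3⟩)) hz2
      · exact h
      · exact absurd hz1 (((key z).1 hz3).2.2 y h hy)
    · rintro rfl
      exact ⟨⟨(hV _ h1).2, h2⟩, hy⟩
  · intro h
    exact ((key x).1 h).1 rfl
  · intro y hy
    by_contra hcon
    push Not at hcon
    have : (P y).down := by
      rw [key]
      exact ⟨hy, fun h => hcon.1 (closure_mono (fun d hd => hd.2) h), fun d _ hd => hcon.2 d hd⟩
    exact hcon.1 (subset_closure this)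

/-- The pseudocharacter is at most the depth. -/
theorem aux_psi {X G : Type u} [TopologicalSpace X] [T2Space X]
    (hg : ∀ D : Set X, DiscreteTopology D → #(closure D) ≤ #G) (x : X) :
    ∃ V : G → Set X, (∀ i, IsOpen (V i) ∧ x ∈ V i) ∧ ∀ y, y ≠ x → ∃ i, y ∉ V i := by
  classical
  have h0 : ∀ y, ∃ V W : Set X, y ≠ x → IsOpen V ∧ IsOpen W ∧ y ∈ V ∧ x ∈ W ∧ Disjoint V W := by
    intro y
    by_cases h : y = x
    · exact ⟨∅, ∅, fun h' => absurd h h'⟩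
    · obtain ⟨V, W, h1⟩ := t2_separation h
      exact ⟨V, W, fun _ => h1⟩
  choose V W hVW using h0
  obtain ⟨D, hD, hxD, hcov⟩ := aux_shap x V (fun y hy => ⟨(hVW y hy).1, (hVW y hy).2.2.1⟩)
  obtain ⟨f, hf⟩ := aux_cover x (closure D) (hg D hD)
  refine ⟨fun i => if f i = x then Set.univ else W (f i), fun i => ?_, fun y hy => ?_⟩
  · by_cases h : f i = x
    · simp [h]
    · simp only [h, if_false]
      exact ⟨(hVW _ h).2.1, (hVW _ h).2.2.2.1⟩
  · have : ∃ c ∈ closure D, c ≠ x ∧ y ∈ V c := by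
      rcases hcov y hy with h | ⟨d, hd, h⟩
      · exact ⟨y, h, hy, (hVW y hy).2.2.1⟩
      · exact ⟨d, subset_closure hd, fun h' => hxD (h' ▸ hd), h⟩
    obtain ⟨c, hc, hcx, hyc⟩ := this
    obtain ⟨i, rfl⟩ := hf hc
    refine ⟨i, ?_⟩
    simp only [hcx, if_false]
    exact fun h => Set.disjoint_left.1 (hVW _ hcx).2.2.2.2 hyc h

/-- Closing off. -/
theorem aux_closing {X G K : Type u} (hK : ℵ₀ ≤ #K) (hG : 2 ≤ #G) (x0 : X)
    (op1 : (K → X) → G → X) (op2 : (K → G) → (K → X) → X) :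
    ∃ H : Set X, #H ≤ #G ^ #K ∧ x0 ∈ H ∧ (∀ y : K → X, (∀ k, y k ∈ H) → ∀ i, op1 y i ∈ H) ∧
      (∀ s : K → G, ∀ y : K → X, (∀ k, y k ∈ H) → op2 s y ∈ H) := by
  let α := Option (G ⊕ (K → G))
  let β : α → Type u := fun a => match a with
    | none => PEmpty
    | some _ => K
  let ev : (Σ a : α, β a → X) → X := fun z => match z with
    | ⟨none, _⟩ => x0
    | ⟨some (Sum.inl i), y⟩ => op1 y i
    | ⟨some (Sum.inr s), y⟩ => op2 s y
  let E : WType β → X := WType.elim X ev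
  have hK0 : #K ≠ 0 := (lt_of_lt_of_le aleph0_pos hK).ne'
  have hGl : #G ≤ #G ^ #K := Cardinal.self_le_power _ (Cardinal.one_le_iff_ne_zero.2 hK0)
  have hl : ℵ₀ ≤ #G ^ #K :=
    (hK.trans (Cardinal.cantor _).le).trans (Cardinal.power_le_power_right hG)
  have hll : (#G ^ #K) ^ #K = #G ^ #K := by
    rw [← Cardinal.power_mul, Cardinal.mul_eq_self hK]
  have hα : #α ≤ #G ^ #K := by
    have : #α = #G + #G ^ #K + 1 := by simp [α]
    rw [this]
    exact add_le_of_le hl (add_le_of_le hl hGl le_rfl) (one_le_aleph0.trans hl)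
  have hW : #(WType β) ≤ #G ^ #K := by
    apply WType.cardinalMk_le_of_le'
    refine (Cardinal.sum_le_mk_mul_iSup _).trans ?_
    refine (mul_le_mul' hα (ciSup_le' (a := #G ^ #K) ?_)).trans (Cardinal.mul_eq_self hl).le
    rintro (_ | a)
    · simpa [β] using one_le_aleph0.trans hl
    · simp only [β, Cardinal.lift_id]
      exact hll.le
  refine ⟨range E, Cardinal.mk_range_le.trans hW, ⟨WType.mk none PEmpty.elim, rfl⟩, ?_, ?_⟩
  · intro y hy i
    choose w hw using hy
    refine ⟨WType.mk (some (Sum.inl i)) w, ?_⟩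
    have : (fun k => E (w k)) = y := funext hw
    rw [← this]
    rfl
  · intro s y hy
    choose w hw using hy
    refine ⟨WType.mk (some (Sum.inr s)) w, ?_⟩
    have : (fun k => E (w k)) = y := funext hw
    rw [← this]
    rfl

theorem aux_H {X G K : Type u} [TopologicalSpace X] (hK : ℵ₀ ≤ #K) (hG : 2 ≤ #G) (x0 : X)
    (hg : ∀ D : Set X, DiscreteTopology D → #(closure D) ≤ #G) (V : X → G → Set X) :
    ∃ H : Set X, #H ≤ #G ^ #K ∧
      (∀ D ⊆ H, #D ≤ #K → DiscreteTopology D → closure D ⊆ H) ∧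
      (∀ 𝒲 : Set (Set X), (∀ U ∈ 𝒲, ∃ x ∈ H, ∃ i, V x i = U) → #𝒲 ≤ #K → ⋃₀ 𝒲 ≠ Set.univ →
        ∃ y ∈ H, y ∉ ⋃₀ 𝒲) := by
  have h1 : ∀ y : K → X, ∃ f : G → X, #(closure (range y)) ≤ #G → closure (range y) ⊆ range f := by
    intro y
    by_cases h : #(closure (range y)) ≤ #G
    · obtain ⟨f, hf⟩ := aux_cover x0 _ h
      exact ⟨f, fun _ => hf⟩
    · exact ⟨fun _ => x0, fun h' => absurd h' h⟩
  have h2 : ∀ (s : K → G) (y : K → X), ∃ z, (⋃ k, V (y k) (s k)) ≠ Set.univ →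
      z ∉ ⋃ k, V (y k) (s k) := by
    intro s y
    by_cases h : (⋃ k, V (y k) (s k)) = Set.univ
    · exact ⟨x0, fun h' => absurd h h'⟩
    · obtain ⟨z, hz⟩ := (Set.ne_univ_iff_exists_notMem _).1 h
      exact ⟨z, fun _ => hz⟩
  choose op1 hop1 using h1
  choose op2 hop2 using h2
  obtain ⟨H, hH, hx0, hc1, hc2⟩ := aux_closing hK hG x0 op1 op2
  refine ⟨H, hH, ?_, ?_⟩
  · intro D hDH hDK hD
    rcases D.eq_empty_or_nonempty with rfl | hne
    · simp
    obtain ⟨y, rfl⟩ := aux_exact D hne hDK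
    intro z hz
    obtain ⟨i, rfl⟩ := hop1 y (hg _ hD) hz
    exact hc1 y (fun k => hDH ⟨k, rfl⟩) i
  · intro 𝒲 hW hWK hWu
    rcases 𝒲.eq_empty_or_nonempty with rfl | hne
    · exact ⟨x0, hx0, by simp⟩
    obtain ⟨U, rfl⟩ := aux_exact 𝒲 hne hWK
    choose y hy s hs using fun k => hW (U k) ⟨k, rfl⟩
    have : (⋃ k, V (y k) (s k)) = ⋃₀ range U := by
      simp [hs]
    refine ⟨op2 s y, hc2 s y hy, ?_⟩
    rw [← this]
    exact hop2 s y (this ▸ hWu)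

theorem aux_main {X G K : Type u} [TopologicalSpace X] [T2Space X] (hK : ℵ₀ ≤ #K) (hG : 2 ≤ #G)
    (hg : ∀ D : Set X, DiscreteTopology D → #(closure D) ≤ #G)
    (hL : ∀ 𝒰 : Set (Set X), (∀ U ∈ 𝒰, IsOpen U) → ⋃₀ 𝒰 = Set.univ →
      ∃ 𝒱 ⊆ 𝒰, #𝒱 ≤ #K ∧ ⋃₀ 𝒱 = Set.univ)
    (ht : ∀ (A : Set X) (x : X), x ∈ closure A → ∃ B ⊆ A, #B ≤ #K ∧ x ∈ closure B) (x0 : X) :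
    #X ≤ #G ^ #K := by
  classical
  have hLc : ∀ (C : Set X), IsClosed C → ∀ 𝒰 : Set (Set X), (∀ U ∈ 𝒰, IsOpen U) → C ⊆ ⋃₀ 𝒰 →
      ∃ 𝒱 ⊆ 𝒰, #𝒱 ≤ #K ∧ C ⊆ ⋃₀ 𝒱 := by
    intro C hC 𝒰 h𝒰 hcov
    obtain ⟨𝒱, h1, h2, h3⟩ := hL (insert Cᶜ 𝒰)
      (by
        rintro U (rfl | hU)
        · exact hC.isOpen_compl
        · exact h𝒰 U hU)
      (by
        rw [Set.eq_univ_iff_forall]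
        intro x
        by_cases hx : x ∈ C
        · obtain ⟨U, hU, hxU⟩ := hcov hx
          exact ⟨U, Or.inr hU, hxU⟩
        · exact ⟨Cᶜ, Or.inl rfl, hx⟩)
    refine ⟨𝒱 ∩ 𝒰, inter_subset_right, (Cardinal.mk_le_mk_of_subset inter_subset_left).trans h2, ?_⟩
    intro x hx
    obtain ⟨U, hU, hxU⟩ := (h3 ▸ mem_univ x : x ∈ ⋃₀ 𝒱)
    rcases h1 hU with rfl | h
    · exact absurd hx hxU
    · exact ⟨U, ⟨hU, h⟩, hxU⟩
  choose V hV hVsep using aux_psi (G := G) hg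
  obtain ⟨H, hHc, hH1, hH2⟩ := aux_H hK hG x0 hg V
  suffices H = Set.univ by
    rw [this, Cardinal.mk_univ] at hHc
    exact hHc
  by_contra hne
  obtain ⟨p, hp⟩ := (Set.ne_univ_iff_exists_notMem _).1 hne
  -- the good families
  let Good : Set (Set X) → Prop := fun 𝒲 =>
    (∀ U ∈ 𝒲, ∃ x ∈ H, ∃ i, V x i = U) ∧ #𝒲 ≤ #K ∧ p ∉ ⋃₀ 𝒲
  have hGopen : ∀ 𝒲, Good 𝒲 → IsOpen (⋃₀ 𝒲) := by
    rintro 𝒲 ⟨h1, -⟩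
    refine isOpen_sUnion fun U hU => ?_
    obtain ⟨x, -, i, rfl⟩ := h1 U hU
    exact (hV x i).1
  have hcover : ∀ C : Set X, IsClosed C → C ⊆ H → ∃ 𝒲, Good 𝒲 ∧ C ⊆ ⋃₀ 𝒲 := by
    intro C hC hCH
    obtain ⟨𝒱, h1, h2, h3⟩ := hLc C hC {U | (∃ x ∈ H, ∃ i, V x i = U) ∧ p ∉ U}
      (by
        rintro U ⟨⟨x, -, i, rfl⟩, -⟩
        exact (hV x i).1)
      (by
        intro x hx
        obtain ⟨i, hi⟩ := hVsep x p (fun h => hp (h ▸ hCH hx))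
        exact ⟨V x i, ⟨⟨x, hCH hx, i, rfl⟩, hi⟩, (hV x i).2⟩)
    exact ⟨𝒱, ⟨fun U hU => (h1 hU).1, h2, fun ⟨U, hU, hpU⟩ => (h1 hU).2 hpU⟩, h3⟩
  have hW0 : ∀ D : Set X, ∃ 𝒲, Good 𝒲 ∧ (closure D ⊆ H → closure D ⊆ ⋃₀ 𝒲) := by
    intro D
    by_cases h : closure D ⊆ H
    · obtain ⟨𝒲, h1, h2⟩ := hcover _ isClosed_closure h
      exact ⟨𝒲, h1, fun _ => h2⟩
    · exact ⟨∅, ⟨by simp, by simp, by simp⟩, fun h' => absurd h' h⟩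
  choose W hWg hWc using hW0
  have hpick0 : ∀ 𝒲 : Set (Set X), ∃ y, Good 𝒲 → y ∈ H ∧ y ∉ ⋃₀ 𝒲 := by
    intro 𝒲
    by_cases h : Good 𝒲
    · obtain ⟨y, hy⟩ := hH2 𝒲 h.1 h.2.1 (fun h' => h.2.2 (h' ▸ mem_univ p))
      exact ⟨y, fun _ => hy⟩
    · exact ⟨x0, fun h' => absurd h' h⟩
  choose pick hpick using hpick0
  let I : Type u := (Order.succ #K).ord.ToType
  have hI : #I = Order.succ #K := Cardinal.mk_ord_toType _
  have hIio : ∀ a : I, #(Iio a) ≤ #K := fun a =>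
    Order.lt_succ_iff.1 (Cardinal.mk_Iio_toType_ord_lt a)
  have hIic : ∀ a : I, #(Iic a) ≤ #K := by
    intro a
    rw [← Set.Iio_insert]
    refine (Cardinal.mk_insert_le).trans ?_
    exact add_le_of_le hK (hIio a) (one_le_aleph0.trans hK)
  have hbdd : ∀ S : Set I, #S ≤ #K → ∃ c, ∀ s ∈ S, s ≤ c := by
    intro S hS
    by_contra hcon
    push Not at hcon
    have h1 : (⋃ s ∈ S, Iic s) = (Set.univ : Set I) := by
      rw [Set.eq_univ_iff_forall]
      intro c
      obtain ⟨s, hs, hcs⟩ := hcon c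
      exact mem_biUnion hs hcs.le
    have h2 := aux_mk_biUnion_le hK S (fun s => Iic s) hS (fun s _ => hIic s)
    rw [h1, Cardinal.mk_univ, hI] at h2
    exact absurd h2 (not_le.2 (Order.lt_succ _))
  let fam : I → (I → X) → Set (Set X) := fun a x =>
    (⋃ b ∈ Iic a, W (x '' Iio b)) ∪ ⋃ b ∈ Iio a, W {x b}
  obtain ⟨x, hx⟩ := aux_rec x0 (fun a x => pick (fam a x)) (by
    intro a x y h
    have h1 : fam a x = fam a y := by
      simp only [fam]
      congr 1
      · refine iUnion₂_congr fun b hb => ?_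
        have h2 : x '' Iio b = y '' Iio b :=
          Set.image_congr fun c (hc : c ∈ Iio b) => h c (lt_of_lt_of_le (mem_Iio.1 hc) hb)
        rw [h2]
      · refine iUnion₂_congr fun b hb => ?_
        rw [h b hb]
    simp only [h1])
  have hfam : ∀ a, Good (fam a x) := by
    intro a
    refine ⟨?_, ?_, ?_⟩
    · rintro U (hU | hU)
      · simp only [mem_iUnion] at hU
        obtain ⟨b, _, hU⟩ := hU
        exact (hWg _).1 U hU
      · simp only [mem_iUnion] at hU
        obtain ⟨b, _, hU⟩ := hU
        exact (hWg _).1 U hU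
    · refine (Cardinal.mk_union_le _ _).trans (add_le_of_le hK ?_ ?_)
      · exact aux_mk_biUnion_le hK _ _ (hIic a) fun b _ => (hWg _).2.1
      · exact aux_mk_biUnion_le hK _ _ (hIio a) fun b _ => (hWg _).2.1
    · rintro ⟨U, hU | hU, hpU⟩
      · simp only [mem_iUnion] at hU
        obtain ⟨b, _, hU⟩ := hU
        exact (hWg _).2.2 ⟨U, hU, hpU⟩
      · simp only [mem_iUnion] at hU
        obtain ⟨b, _, hU⟩ := hU
        exact (hWg _).2.2 ⟨U, hU, hpU⟩
  have hxH : ∀ a, x a ∈ H := by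
    intro a
    rw [hx a]
    exact (hpick _ (hfam a)).1
  have hxn : ∀ a, x a ∉ ⋃₀ fam a x := by
    intro a
    have := (hpick _ (hfam a)).2
    rwa [← hx a] at this
  have hxn1 : ∀ a b, b ≤ a → x a ∉ ⋃₀ W (x '' Iio b) := by
    rintro a b hb ⟨U, hU, hxU⟩
    exact hxn a ⟨U, Or.inl (mem_biUnion (show b ∈ Iic a from hb) hU), hxU⟩
  have hxn2 : ∀ a b, b < a → x a ∉ ⋃₀ W {x b} := by
    rintro a b hb ⟨U, hU, hxU⟩
    exact hxn a ⟨U, Or.inr (mem_biUnion (show b ∈ Iio a from hb) hU), hxU⟩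
  have hsing : ∀ a, x a ∈ ⋃₀ W {x a} := by
    intro a
    apply hWc {x a}
    · simpa using hxH a
    · simp
  have hDcov : ∀ a, closure (x '' Iio a) ⊆ ⋃₀ W (x '' Iio a) := by
    intro a
    induction a using WellFoundedLT.induction with
    | ind a ih =>
      apply hWc
      apply hH1
      · rintro _ ⟨b, -, rfl⟩
        exact hxH b
      · exact Cardinal.mk_image_le.trans (hIio a)
      · rw [discreteTopology_subtype_iff']
        rintro _ ⟨b, hb, rfl⟩
        refine ⟨⋃₀ W {x b} ∩ (closure (x '' Iio b))ᶜ,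
          (hGopen _ (hWg _)).inter isClosed_closure.isOpen_compl, ?_⟩
        ext z
        constructor
        · rintro ⟨⟨hz1, hz2⟩, ⟨c, hc, rfl⟩⟩
          rcases lt_trichotomy c b with h | h | h
          · exact absurd (subset_closure (show x c ∈ x '' Iio b from ⟨c, h, rfl⟩)) hz2
          · rw [h]; rfl
          · exact absurd hz1 (hxn2 c b h)
        · rintro rfl
          exact ⟨⟨hsing b, fun h => hxn1 b b le_rfl (ih b hb h)⟩, ⟨b, hb, rfl⟩⟩
  -- the final contradiction
  obtain ⟨𝒱, h1, h2, h3⟩ := hLc (closure (range x)) isClosed_closure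
    (range fun a => ⋃₀ W (x '' Iio a))
    (by
      rintro _ ⟨a, rfl⟩
      exact hGopen _ (hWg _))
    (by
      intro z hz
      obtain ⟨B, hB, hBK, hzB⟩ := ht _ z hz
      choose c hc using fun b : B => hB b.2
      obtain ⟨m, hm⟩ := hbdd (range c) (Cardinal.mk_range_le.trans hBK)
      by_cases hmax : ∃ m', m < m'
      · obtain ⟨m', hm'⟩ := hmax
        refine ⟨_, ⟨m', rfl⟩, hDcov m' (closure_mono ?_ hzB)⟩
        intro b hb
        exact ⟨c ⟨b, hb⟩, lt_of_le_of_lt (hm _ ⟨_, rfl⟩) hm', hc ⟨b, hb⟩⟩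
      · exfalso
        push Not at hmax
        have h4 : Iic m = Set.univ := Set.eq_univ_iff_forall.2 hmax
        have h5 := hIic m
        rw [h4, Cardinal.mk_univ, hI] at h5
        exact absurd h5 (not_le.2 (Order.lt_succ _)))
  choose c hc using fun U : 𝒱 => h1 U.2
  obtain ⟨m, hm⟩ := hbdd (range c) (Cardinal.mk_range_le.trans h2)
  obtain ⟨U, hU, hxU⟩ := h3 (subset_closure ⟨m, rfl⟩ : x m ∈ closure (range x))
  have h6 := hc ⟨U, hU⟩
  simp only at h6
  rw [← h6] at hxU
  exact hxn1 m _ (hm _ ⟨_, rfl⟩) hxU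

theorem aux_L (X : Type u) [TopologicalSpace X] :
    ℵ₀ ≤ lindelofNumber X ∧ ∀ 𝒰 : Set (Set X), (∀ U ∈ 𝒰, IsOpen U) → ⋃₀ 𝒰 = Set.univ →
    ∃ 𝒱 ⊆ 𝒰, #𝒱 ≤ lindelofNumber X ∧ ⋃₀ 𝒱 = Set.univ := by
  have := csInf_mem (s := {κ : Cardinal.{u} | ℵ₀ ≤ κ ∧ ∀ 𝒰 : Set (Set X), (∀ U ∈ 𝒰, IsOpen U) →
    ⋃₀ 𝒰 = Set.univ → ∃ 𝒱 ⊆ 𝒰, #𝒱 ≤ κ ∧ ⋃₀ 𝒱 = Set.univ})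
    ⟨max ℵ₀ #(Set X), le_max_left _ _, fun 𝒰 _ h =>
      ⟨𝒰, subset_rfl, (Cardinal.mk_set_le _).trans (le_max_right _ _), h⟩⟩
  exact this

theorem aux_t (X : Type u) [TopologicalSpace X] :
    ℵ₀ ≤ tightness X ∧ ∀ (A : Set X) (x : X), x ∈ closure A →
    ∃ B ⊆ A, #B ≤ tightness X ∧ x ∈ closure B := by
  have := csInf_mem (s := {κ : Cardinal.{u} | ℵ₀ ≤ κ ∧ ∀ (A : Set X) (x : X), x ∈ closure A →
    ∃ B ⊆ A, #B ≤ κ ∧ x ∈ closure B})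
    ⟨max ℵ₀ #X, le_max_left _ _, fun A x h =>
      ⟨A, subset_rfl, (Cardinal.mk_set_le _).trans (le_max_right _ _), h⟩⟩
  exact this

theorem aux_g (X : Type u) [TopologicalSpace X] (D : Set X) (hD : DiscreteTopology D) :
    #(closure D) ≤ depth X :=
  le_ciSup (f := fun D : {D : Set X // DiscreteTopology D} => #(closure (D : Set X)))
    (Cardinal.bddAbove_range _) ⟨D, hD⟩

/-- For every Hausdorff space `X`, `|X| ≤ g(X)^{L(X)·t(X)}`. -/
theorem cardinality_le_depth_pow_lindelof_mul_tightness (X : Type u) [TopologicalSpace X]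
    [T2Space X] :
    #X ≤ depth X ^ (lindelofNumber X * tightness X) := by
  obtain ⟨hL0, hL⟩ := aux_L X
  obtain ⟨ht0, ht⟩ := aux_t X
  have hLt : lindelofNumber X ≤ lindelofNumber X * tightness X :=
    Cardinal.le_mul_right (aleph0_pos.trans_le ht0).ne'
  have htL : tightness X ≤ lindelofNumber X * tightness X :=
    Cardinal.le_mul_left (aleph0_pos.trans_le hL0).ne'
  have hfin : ∀ F : Set X, F.Finite → #F ≤ depth X := by
    intro F hF
    haveI := hF.to_subtype
    exact (Cardinal.mk_le_mk_of_subset subset_closure).trans (aux_g X F inferInstance)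
  rcases isEmpty_or_nonempty X with hX | ⟨⟨x0⟩⟩
  · simp
  rcases subsingleton_or_nontrivial X with hX | hX
  · have h1 : #X ≤ 1 := Cardinal.le_one_iff_subsingleton.2 hX
    have h2 : (1 : Cardinal.{u}) ≤ depth X := by simpa using hfin {x0} (finite_singleton _)
    refine h1.trans (Cardinal.one_le_iff_ne_zero.2 (Cardinal.power_ne_zero _ ?_))
    exact Cardinal.one_le_iff_ne_zero.1 h2
  · obtain ⟨a, b, hab⟩ := exists_pair_ne X
    have h2 : (2 : Cardinal.{u}) ≤ depth X := by
      have := hfin {a, b} (by simp)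
      rwa [Cardinal.mk_insert (by simpa using hab), Cardinal.mk_singleton, one_add_one_eq_two]
        at this
    have := aux_main (X := X) (G := (depth X).out) (K := (lindelofNumber X * tightness X).out)
      (by rw [Cardinal.mk_out]; exact hL0.trans hLt) (by rwa [Cardinal.mk_out])
      (by rw [Cardinal.mk_out]; exact aux_g X)
      (by
        rw [Cardinal.mk_out]
        intro 𝒰 h1 h2
        obtain ⟨𝒱, h3, h4, h5⟩ := hL 𝒰 h1 h2
        exact ⟨𝒱, h3, h4.trans hLt, h5⟩)
      (by
        rw [Cardinal.mk_out]
        intro A x hx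
        obtain ⟨B, h3, h4, h5⟩ := ht A x hx
        exact ⟨B, h3, h4.trans htL, h5⟩) x0
    rwa [Cardinal.mk_out, Cardinal.mk_out] at this
end

section
/- Let X be a compact Hausdorff topological space of countable tightness. Then the cardinality of X is at most g(X)^{ℵ₀}, where g(X) is the depth of X. -/
open Cardinal Set

universe u

/-- Arities of the operations used in the closing-off argument. -/
def closingArity (A : Type u) : Option A → Type
  | none => Empty
  | some _ => ℕ

lemma exists_closing_set {X I : Type u} (hI : 2 ≤ #I) (F : (ℕ → I) → (ℕ → X) → X)
    (G : I → (ℕ → X) → X) (x0 : X) :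
    ∃ M : Set X, #M ≤ #I ^ ℵ₀ ∧ x0 ∈ M ∧
      ∀ x : ℕ → X, (∀ n, x n ∈ M) → (∀ c, F c x ∈ M) ∧ ∀ i, G i x ∈ M := by
  let A := (ℕ → I) ⊕ I
  let step : (Σ a : Option A, closingArity A a → X) → X := fun p =>
    match p with
    | ⟨none, _⟩ => x0
    | ⟨some (Sum.inl c), f⟩ => F c f
    | ⟨some (Sum.inr i), f⟩ => G i f
  let ev : WType (closingArity A) → X := WType.elim X step
  have hk : ℵ₀ ≤ #I ^ ℵ₀ :=
    (cantor ℵ₀).le.trans (power_le_power_right hI)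
  have hkk : (#I ^ ℵ₀) ^ ℵ₀ = #I ^ ℵ₀ := by
    rw [← power_mul, aleph0_mul_aleph0]
  have hIk : #I ≤ #I ^ ℵ₀ := self_le_power _ one_le_aleph0
  have hA : #(Option A) ≤ #I ^ ℵ₀ := by
    rw [mk_option]
    have h1 : #A ≤ #I ^ ℵ₀ := by
      have : #A = #I ^ ℵ₀ + #I := by simp [A]
      rw [this]
      exact add_le_of_le hk le_rfl hIk
    exact add_le_of_le hk h1 (one_le_aleph0.trans hk)
  have hW : #(WType (closingArity A)) ≤ #I ^ ℵ₀ := by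
    apply WType.cardinalMk_le_of_le'
    calc (sum fun a : Option A => (#I ^ ℵ₀) ^ lift.{u} #(closingArity A a))
        ≤ sum fun a : Option A => (#I ^ ℵ₀) := by
          apply sum_le_sum
          intro a
          rcases a with _ | a
          · have : #(closingArity A none) = 0 := by simp [closingArity]
            rw [this]
            simpa using one_le_aleph0.trans hk
          · have : #(closingArity A (some a)) = ℵ₀ := by simp [closingArity]
            rw [this, lift_aleph0, hkk]
      _ = #(Option A) * (#I ^ ℵ₀) := by simp
      _ ≤ _ := mul_le_of_le hk hA le_rfl
  refine ⟨range ev, mk_range_le.trans hW, ⟨WType.mk none Empty.elim, rfl⟩, ?_⟩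
  intro x hx
  choose w hw using hx
  have hxw : x = fun n => ev (w n) := funext fun n => (hw n).symm
  subst hxw
  exact ⟨fun c => ⟨WType.mk (some (Sum.inl c)) w, rfl⟩,
    fun i => ⟨WType.mk (some (Sum.inr i)) w, rfl⟩⟩

lemma discrete_of_wellOrdered {X : Type u} [TopologicalSpace X] {ι : Type*} [LinearOrder ι]
    (S : Set ι) (x : ι → X) (N : ι → Set X) (hN : ∀ i ∈ S, IsOpen (N i)) (hx : ∀ i ∈ S, x i ∈ N i)
    (h1 : ∀ i ∈ S, ∀ j ∈ S, i < j → x j ∉ N i)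
    (h2 : ∀ i ∈ S, x i ∉ closure (x '' (S ∩ Iio i))) : DiscreteTopology (x '' S) := by
  rw [discreteTopology_subtype_iff']
  rintro _ ⟨i, hi, rfl⟩
  refine ⟨N i \ closure (x '' (S ∩ Iio i)), (hN i hi).sdiff isClosed_closure, ?_⟩
  apply Subset.antisymm
  · rintro _ ⟨⟨ha, hb⟩, j, hj, rfl⟩
    rcases lt_trichotomy i j with h | h | h
    · exact (h1 i hi j hj h ha).elim
    · simp [h]
    · exact (hb (subset_closure ⟨j, ⟨hj, h⟩, rfl⟩)).elim
  · rintro _ rfl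
    exact ⟨⟨hx i hi, h2 i hi⟩, i, hi, rfl⟩

lemma exists_rec {ι : Type*} {X : Type*} [LinearOrder ι] [WellFoundedLT ι]
    (P : ∀ i : ι, (∀ j, j < i → X) → X → Prop) (h : ∀ i f, ∃ y, P i f y) :
    ∃ x : ι → X, ∀ i, P i (fun j _ => x j) (x i) := by
  choose g hg using h
  refine ⟨(wellFounded_lt (α := ι)).fix g, fun i => ?_⟩
  rw [WellFounded.fix_eq]
  exact hg _ _

/-- Shapirovskii's lemma. -/
lemma exists_discrete_cover {X : Type u} [TopologicalSpace X] (Y : Set X) (V : X → Set X)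
    (hV : ∀ y ∈ Y, IsOpen (V y)) (hy : ∀ y ∈ Y, y ∈ V y) :
    ∃ D ⊆ Y, DiscreteTopology D ∧ ∀ y ∈ Y, y ∈ closure D ∨ ∃ d ∈ D, y ∈ V d := by
  classical
  obtain ⟨_, _⟩ := exists_wellFoundedLT X
  obtain ⟨p, hp⟩ := exists_rec (ι := X) (X := Prop)
    (fun i f q => q ↔ (i ∈ Y ∧ i ∉ closure {z | ∃ h : z < i, f z h} ∧
      ∀ z (h : z < i), f z h → i ∉ V z)) (fun i f => ⟨_, Iff.rfl⟩)
  have hD : DiscreteTopology (id '' {z | p z}) := by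
    apply discrete_of_wellOrdered (N := V)
    · exact fun i hi => hV i ((hp i).1 hi).1
    · exact fun i hi => hy i ((hp i).1 hi).1
    · exact fun i hi j hj hij => ((hp j).1 hj).2.2 i hij hi
    · intro i hi h
      refine ((hp i).1 hi).2.1 (closure_mono ?_ h)
      rintro _ ⟨z, ⟨hz, hz'⟩, rfl⟩
      exact ⟨hz', hz⟩
  rw [image_id] at hD
  refine ⟨{z | p z}, fun i hi => ((hp i).1 hi).1, hD, fun y hyY => ?_⟩
  by_contra hcon
  push Not at hcon
  have : p y := by
    refine (hp y).2 ⟨hyY, fun h => hcon.1 (closure_mono ?_ h), fun z _ hz => hcon.2 z hz⟩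
    rintro z ⟨_, hz⟩
    exact hz
  exact hcon.1 (subset_closure this)

lemma closure_le_depth {X : Type u} [TopologicalSpace X] (D : Set X) (hD : DiscreteTopology D) :
    #(closure D) ≤ depth X :=
  le_ciSup (f := fun D : {D : Set X // DiscreteTopology D} => #(closure (D : Set X)))
    bddAbove_of_small ⟨D, hD⟩

/-- The pseudocharacter is at most the depth. -/
lemma exists_pseudobase {X I : Type u} [TopologicalSpace X] [T2Space X] (hI : #I = depth X)
    (x : X) : ∃ U : I → Set X, (∀ i, IsOpen (U i)) ∧ (∀ i, x ∈ U i) ∧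
      ∀ p, p ≠ x → ∃ i, p ∉ U i := by
  have h : ∀ y : X, ∃ V W : Set X, IsOpen V ∧ IsOpen W ∧ x ∈ W ∧ (y ≠ x → y ∈ V) ∧ Disjoint V W := by
    intro y
    by_cases hyx : y = x
    · exact ⟨∅, univ, isOpen_empty, isOpen_univ, mem_univ _, fun h => (h hyx).elim, by simp⟩
    · obtain ⟨V, W, hV, hW, hy, hx, hd⟩ := t2_separation hyx
      exact ⟨V, W, hV, hW, hx, fun _ => hy, hd⟩
  choose V W hV hW hx hy hd using h
  obtain ⟨D, hDY, hD, hc⟩ := exists_discrete_cover {y | y ≠ x} V (fun y _ => hV y) (fun y h => hy y h)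
  have hle : #(closure D) ≤ #I := hI ▸ closure_le_depth D hD
  obtain ⟨e⟩ := hle
  refine ⟨Function.extend e (fun y => W y) (fun _ => univ), ?_, ?_, ?_⟩
  · intro i
    by_cases hi : ∃ y, e y = i
    · obtain ⟨y, rfl⟩ := hi
      rw [e.injective.extend_apply]; exact hW _
    · rw [Function.extend_apply' _ _ _ hi]; exact isOpen_univ
  · intro i
    by_cases hi : ∃ y, e y = i
    · obtain ⟨y, rfl⟩ := hi
      rw [e.injective.extend_apply]; exact hx _
    · rw [Function.extend_apply' _ _ _ hi]; trivial
  · intro p hp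
    have key : ∃ d ∈ closure D, p ∈ V d := by
      rcases hc p hp with h | ⟨d, hdD, h⟩
      · exact ⟨p, h, hy p hp⟩
      · exact ⟨d, subset_closure hdD, h⟩
    obtain ⟨d, hdD, h⟩ := key
    refine ⟨e ⟨d, hdD⟩, ?_⟩
    rw [e.injective.extend_apply]
    exact disjoint_left.1 (hd d) h

/-- The free sequence argument. -/
lemma no_missing_point {X : Type u} [TopologicalSpace X] [CompactSpace X]
    (ht : ∀ (A : Set X) (x : X), x ∈ closure A → ∃ B ⊆ A, B.Countable ∧ x ∈ closure B)
    (M : Set X) (𝒰 : Set (Set X)) (hopen : ∀ V ∈ 𝒰, IsOpen V)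
    (hunion : ∀ 𝒱 : Set (Set X), 𝒱.Countable → 𝒱 ⊆ 𝒰 → ⋃₀ 𝒱 ∈ 𝒰)
    (hpt : ∀ y ∈ M, ∃ V ∈ 𝒰, y ∈ V)
    (hpick : ∀ V ∈ 𝒰, ∃ y ∈ M, y ∉ V)
    (hcl : ∀ A : Set X, A ⊆ M → A.Countable → DiscreteTopology A → closure A ⊆ M) : False := by
  have hempty : ∅ ∈ 𝒰 := by simpa using hunion ∅ countable_empty (empty_subset _)
  have hN : ∀ y, ∃ V ∈ 𝒰, y ∈ M → y ∈ V := fun y => by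
    by_cases hy : y ∈ M
    · obtain ⟨V, h1, h2⟩ := hpt y hy
      exact ⟨V, h1, fun _ => h2⟩
    · exact ⟨∅, hempty, fun h => (hy h).elim⟩
  choose N hNU hNy using hN
  have hV : ∀ A : Set X, ∃ V ∈ 𝒰, closure A ⊆ M → closure A ⊆ V := fun A => by
    by_cases hA : closure A ⊆ M
    · obtain ⟨t, ht1, ht2⟩ := (isClosed_closure (s := A)).isCompact.elim_nhds_subcover N
        (fun y hy => (hopen _ (hNU y)).mem_nhds (hNy y (hA hy)))
      refine ⟨⋃₀ (N '' t), hunion _ (t.countable_toSet.image N) ?_, fun _ => ?_⟩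
      · rintro _ ⟨y, _, rfl⟩
        exact hNU y
      · simpa [sUnion_image] using ht2
    · exact ⟨∅, hempty, fun h => (hA h).elim⟩
  choose V hVU hVA using hV
  let ι := (ℵ₁ : Cardinal.{0}).ord.ToType
  have hIio : ∀ i : ι, (Iio i).Countable := fun i => by
    have := mk_Iio_toType_ord_lt i
    rw [← le_aleph0_iff_set_countable]
    exact Order.lt_succ_iff.1 (this.trans_eq succ_aleph0.symm)
  have hIic : ∀ i : ι, (Iic i).Countable := fun i => by
    rw [← Iio_insert]
    exact (hIio i).insert i
  have hunc : ¬ (univ : Set ι).Countable := by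
    rw [← le_aleph0_iff_set_countable, mk_univ, mk_toType, card_ord, not_le]
    exact aleph0_lt_aleph_one
  obtain ⟨x, hx⟩ := exists_rec (ι := ι) (X := X)
    (fun i f y => y ∈ M ∧ (∀ j (h : j < i), y ∉ N (f j h)) ∧
      ∀ k (hk : k ≤ i), y ∉ V {z | ∃ j, ∃ h : j < k, f j (h.trans_le hk) = z}) (by
    intro i f
    obtain ⟨y, hyM, hy⟩ := hpick (⋃₀ ((range fun j : Iio i => N (f j.1 j.2)) ∪
        (range fun k : Iic i => V {z | ∃ j, ∃ h : j < k.1, f j (h.trans_le k.2) = z}))) (by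
      have := (hIio i).to_subtype
      have := (hIic i).to_subtype
      refine hunion _ ((countable_range _).union (countable_range _)) ?_
      rintro _ (⟨j, rfl⟩ | ⟨k, rfl⟩)
      · exact hNU _
      · exact hVU _)
    refine ⟨y, hyM, fun j h hyj => hy ?_, fun k hk hyk => hy ?_⟩
    · exact ⟨_, Or.inl ⟨⟨j, h⟩, rfl⟩, hyj⟩
    · exact ⟨_, Or.inr ⟨⟨k, hk⟩, rfl⟩, hyk⟩)
  have hxM : ∀ i, x i ∈ M := fun i => (hx i).1
  have hxN : ∀ i j, j < i → x i ∉ N (x j) := fun i => (hx i).2.1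
  have hxV : ∀ i k, k ≤ i → x i ∉ V (x '' Iio k) := fun i k hk => by
    have := (hx i).2.2 k hk
    have e : {z | ∃ j, ∃ _ : j < k, x j = z} = x '' Iio k := by
      ext z; simp
    rwa [e] at this
  have hA : ∀ i, closure (x '' Iio i) ⊆ M := by
    intro i
    induction i using WellFoundedLT.induction with
    | ind i ih =>
      apply hcl
      · rintro _ ⟨j, _, rfl⟩
        exact hxM j
      · exact (hIio i).image x
      · apply discrete_of_wellOrdered (N := fun j => N (x j))
        · exact fun j _ => hopen _ (hNU _)
        · exact fun j _ => hNy _ (hxM j)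
        · exact fun j _ k _ hjk => hxN k j hjk
        · intro j hj h
          refine hxV j j le_rfl (hVA _ (ih j hj) (closure_mono ?_ h))
          exact image_mono inter_subset_right
  have hne : Nonempty ι := by
    by_contra h
    rw [not_nonempty_iff] at h
    exact hunc (countable_univ)
  obtain ⟨q, -, hq⟩ := isCompact_univ.exists_mapClusterPt (f := (Filter.atTop : Filter ι)) (u := x)
    (by simp)
  have hq1 : ∀ i, q ∈ closure (x '' Ici i) := fun i => by
    rw [mem_closure_iff_clusterPt]
    exact hq.clusterPt.mono (Filter.le_principal_iff.2 (Filter.image_mem_map (Filter.Ici_mem_atTop i)))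
  have hq2 : q ∈ closure (range x) := closure_mono (image_subset_range _ _) (hq1 hne.some)
  obtain ⟨B, hB, hBc, hqB⟩ := ht _ _ hq2
  have hbd : ∃ i, B ⊆ x '' Iio i := by
    have hB' : ∀ b ∈ B, ∃ i, x i = b := fun b hb => hB hb
    choose! s hs using hB'
    by_contra hcon
    push Not at hcon
    apply hunc
    refine (hBc.biUnion (fun b _ => hIic (s b))).mono fun i _ => ?_
    obtain ⟨b, hb, hb'⟩ := not_subset.1 (hcon i)
    refine mem_biUnion hb ?_
    by_contra h
    exact hb' ⟨s b, by simpa using h, hs b hb⟩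
  obtain ⟨i, hi⟩ := hbd
  have h1 : q ∈ V (x '' Iio i) := hVA _ (hA i) (closure_mono hi hqB)
  obtain ⟨_, hz, j, hj, rfl⟩ := mem_closure_iff.1 (hq1 i) _ (hopen _ (hVU _)) h1
  exact hxV j i hj hz

/-- For every compact Hausdorff space `X` of countable tightness, `|X| ≤ g(X)^ℵ₀`. -/
theorem cardinality_le_depth_pow_aleph0 (X : Type u) [TopologicalSpace X] [T2Space X]
    [CompactSpace X]
    (ht : ∀ (A : Set X) (x : X), x ∈ closure A → ∃ B ⊆ A, B.Countable ∧ x ∈ closure B) :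
    #X ≤ depth X ^ ℵ₀ := by
  classical
  rcases isEmpty_or_nonempty X with hX | ⟨⟨x0⟩⟩
  · simp
  have hfin : ∀ S : Set X, S.Finite → #S ≤ depth X := fun S hS => by
    have : Finite S := hS
    exact (mk_le_mk_of_subset subset_closure).trans (closure_le_depth S inferInstance)
  rcases subsingleton_or_nontrivial X with hX | hX
  · have h1 : #X ≤ 1 := le_one_iff_subsingleton.2 hX
    have h2 : 1 ≤ depth X := by simpa using hfin {x0} (finite_singleton _)
    exact h1.trans (h2.trans (self_le_power _ one_le_aleph0))
  obtain ⟨a, b, hab⟩ := exists_pair_ne X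
  have h2 : 2 ≤ depth X := by
    have := hfin {a, b} (toFinite _)
    have e : #({a, b} : Set X) = 2 := by
      rw [mk_insert (by simpa using hab), mk_singleton]; norm_num
    rwa [e] at this
  obtain ⟨I, hI⟩ : ∃ I : Type u, #I = depth X := ⟨(depth X).out, mk_out _⟩
  choose U hUo hUx hUp using exists_pseudobase (X := X) hI
  have hF : ∀ (c : ℕ → I) (x : ℕ → X), ∃ y, (∃ z, z ∉ ⋃ n, U (x n) (c n)) → y ∉ ⋃ n, U (x n) (c n) := by
    intro c x
    by_cases h : ∃ z, z ∉ ⋃ n, U (x n) (c n)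
    · exact ⟨h.choose, fun _ => h.choose_spec⟩
    · exact ⟨x0, fun h' => (h h').elim⟩
  choose F hF using hF
  have hG : ∀ x : ℕ → X, ∃ g : I → X, DiscreteTopology (range x) → closure (range x) ⊆ range g := by
    intro x
    by_cases h : DiscreteTopology (range x)
    · have hle : #(closure (range x)) ≤ #I := hI ▸ closure_le_depth _ h
      obtain ⟨e⟩ := hle
      refine ⟨Function.extend e (fun y => (y : X)) (fun _ => x0), fun _ y hy => ⟨e ⟨y, hy⟩, ?_⟩⟩
      rw [e.injective.extend_apply]
    · exact ⟨fun _ => x0, fun h' => (h h').elim⟩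
  choose G hG using hG
  obtain ⟨M, hM, hx0, hcl⟩ := exists_closing_set (hI ▸ h2) F (fun i x => G x i) x0
  rw [← hI]
  suffices h : ∀ p, p ∈ M by
    rw [← mk_univ, ← eq_univ_of_forall h]; exact hM
  intro p
  by_contra hp
  let fam : Set (M × I) := {s | p ∉ U s.1 s.2}
  have hfam0 : ∀ y ∈ M, ∃ i, p ∉ U y i := fun y hy => hUp y p (fun h => hp (h ▸ hy))
  refine no_missing_point ht M
    {V | ∃ S : Set (M × I), S.Countable ∧ S ⊆ fam ∧ V = ⋃ s ∈ S, U s.1 s.2} ?_ ?_ ?_ ?_ ?_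
  · rintro _ ⟨S, _, _, rfl⟩
    exact isOpen_biUnion fun s _ => hUo _ _
  · intro 𝒱 h𝒱 hsub
    have hsub' : ∀ V ∈ 𝒱, ∃ S : Set (M × I), S.Countable ∧ S ⊆ fam ∧
        V = ⋃ s ∈ S, U s.1 s.2 := fun V hV => hsub hV
    choose! T hT1 hT2 hT3 using hsub'
    refine ⟨⋃ V ∈ 𝒱, T V, h𝒱.biUnion fun V hV => hT1 V hV, iUnion₂_subset fun V hV => hT2 V hV, ?_⟩
    ext z
    simp only [mem_sUnion, mem_iUnion, exists_prop]
    constructor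
    · rintro ⟨V, hV, hz⟩
      rw [hT3 V hV] at hz
      simp only [mem_iUnion, exists_prop] at hz
      obtain ⟨s, hs, hz⟩ := hz
      exact ⟨s, ⟨V, hV, hs⟩, hz⟩
    · rintro ⟨s, ⟨V, hV, hs⟩, hz⟩
      refine ⟨V, hV, ?_⟩
      rw [hT3 V hV]
      simp only [mem_iUnion, exists_prop]
      exact ⟨s, hs, hz⟩
  · intro y hy
    obtain ⟨i, hi⟩ := hfam0 y hy
    refine ⟨_, ⟨{(⟨y, hy⟩, i)}, countable_singleton _, ?_, rfl⟩, ?_⟩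
    · simpa [fam] using hi
    · simpa using hUx y i
  · rintro _ ⟨S, hS, hSf, rfl⟩
    obtain ⟨i0, hi0⟩ := hfam0 x0 hx0
    obtain ⟨f, hf⟩ := (hS.insert (⟨x0, hx0⟩, i0)).exists_eq_range (insert_nonempty _ _)
    have hff : ∀ n, f n ∈ fam := fun n => by
      have : f n ∈ insert ((⟨x0, hx0⟩ : M), i0) S := hf ▸ mem_range_self n
      rcases this with h | h
      · rw [h]; exact hi0
      · exact hSf h
    refine ⟨F (fun n => (f n).2) (fun n => (f n).1), (hcl _ fun n => (f n).1.2).1 _, ?_⟩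
    have h := hF (fun n => (f n).2) (fun n => (f n).1) ⟨p, by
      simp only [mem_iUnion, not_exists]
      exact fun n => hff n⟩
    intro h'
    apply h
    simp only [mem_iUnion, exists_prop] at h' ⊢
    obtain ⟨s, hs, hz⟩ := h'
    have : s ∈ range f := hf ▸ mem_insert_of_mem _ hs
    obtain ⟨n, rfl⟩ := this
    exact ⟨n, hz⟩
  · intro A hAM hAc hAd
    rcases A.eq_empty_or_nonempty with rfl | hne
    · simp
    obtain ⟨f, rfl⟩ := hAc.exists_eq_range hne
    intro y hy
    obtain ⟨i, rfl⟩ := hG f hAd hy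
    exact (hcl f fun n => hAM (mem_range_self n)).2 i
end
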